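/- Let E be a finite-dimensional real normed vector space, let x₀ ∈ E, and let v_1, …, v_m : E → ℝ be functions that are twice continuously differentiable on a neighborhood of x₀, satisfy v_i(x₀) = 0 for all i, and whose differentials Dv_1(x₀), …, Dv_m(x₀) are linearly independent in the dual space E*. If c_1, …, c_m are real numbers such that Σ_{i=1}^m c_i · v_i(x)² = 0 for all x in some neighborhood of x₀, then c_1 = ⋯ = c_m = 0. Consequently, the squares v_1², …, v_m² of functions whose nodal sets intersect transversally are linearly independent functions. -/

import Mathlib

open Filter Topology

/-- Finitely many linearly independent functionals can be separated: for each one there is a vector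
on which it does not vanish while all the others do. -/
lemma LinearIndependent.exists_apply_ne_zero_of_forall_ne {ι E : Type*} [Finite ι]
    [NormedAddCommGroup E] [NormedSpace ℝ E] {L : ι → E →L[ℝ] ℝ}
    (hL : LinearIndependent ℝ L) (j : ι) :
    ∃ u : E, L j u ≠ 0 ∧ ∀ i, i ≠ j → L i u = 0 := by
  by_contra! h
  have hL' : LinearIndependent ℝ (fun i => (L i : E →ₗ[ℝ] ℝ)) :=
    hL.map' (ContinuousLinearMap.coeLM ℝ)
      (LinearMap.ker_eq_bot.2 ContinuousLinearMap.coe_injective)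
  have hmem : (L j : E →ₗ[ℝ] ℝ) ∈ Submodule.span ℝ
      (Set.range fun i : {i // i ≠ j} => (L i : E →ₗ[ℝ] ℝ)) := by
    refine mem_span_of_iInf_ker_le_ker fun u hu => ?_
    simp only [Submodule.mem_iInf, LinearMap.mem_ker, ContinuousLinearMap.coe_coe] at hu ⊢
    by_contra hj
    obtain ⟨i, hi, hne⟩ := h u hj
    exact hne (hu ⟨i, hi⟩)
  refine hL'.notMem_span_image (s := {i | i ≠ j}) (x := j) (by simp) ?_
  rwa [Set.image_eq_range]

/-- If `∑ i, c i * (v i)²` vanishes near a common zero `x₀` of the `v i`, then the quadratic form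
`∑ i, c i * (D(v i)(x₀) u)²` vanishes identically. -/
lemma sum_mul_fderiv_sq_eq_zero {ι E : Type*} [Fintype ι] [NormedAddCommGroup E]
    [NormedSpace ℝ E] {x₀ : E} {v : ι → E → ℝ} {c : ι → ℝ}
    (hv : ∀ i, DifferentiableAt ℝ (v i) x₀) (hzero : ∀ i, v i x₀ = 0)
    (hc : ∀ᶠ x in 𝓝 x₀, ∑ i, c i * v i x ^ 2 = 0) (u : E) :
    ∑ i, c i * fderiv ℝ (v i) x₀ u ^ 2 = 0 := by
  have hlim : Tendsto (fun t : ℝ => ∑ i, c i * (t⁻¹ • (v i (x₀ + t • u) - v i x₀)) ^ 2) (𝓝[≠] 0)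
      (𝓝 (∑ i, c i * fderiv ℝ (v i) x₀ u ^ 2)) :=
    tendsto_finsetSum _ fun i _ =>
      (((hv i).hasFDerivAt.hasLineDerivAt u).tendsto_slope_zero.pow 2).const_mul _
  have hline : Tendsto (fun t : ℝ => x₀ + t • u) (𝓝[≠] 0) (𝓝 x₀) := by
    have : Continuous fun t : ℝ => x₀ + t • u := by fun_prop
    simpa using (this.tendsto 0).mono_left nhdsWithin_le_nhds
  refine tendsto_nhds_unique hlim (tendsto_const_nhds.congr' ?_)
  filter_upwards [hline.eventually hc] with t ht
  simp only [hzero, sub_zero, smul_eq_mul, mul_pow, mul_left_comm (c _), ← Finset.mul_sum, ht,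
    mul_zero]


/-- Squares of functions with transversally intersecting nodal sets are linearly
independent: if `v 1, …, v m : E → ℝ` are `C²` on a neighborhood of `x₀`, vanish at
`x₀`, and their differentials at `x₀` are linearly independent in the dual `E →L[ℝ] ℝ`,
then any vanishing linear combination `∑ i, c i * (v i x)²` near `x₀` has all
coefficients zero. -/
theorem stmt_5 {E : Type*} [NormedAddCommGroup E] [NormedSpace ℝ E]
    [FiniteDimensional ℝ E] (x₀ : E) (m : ℕ) (v : Fin m → E → ℝ)
    (U : Set E) (hU : U ∈ nhds x₀)
    (hreg : ∀ i, ContDiffOn ℝ 2 (v i) U)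
    (hzero : ∀ i, v i x₀ = 0)
    (hind : LinearIndependent ℝ (fun i : Fin m => fderiv ℝ (v i) x₀))
    (c : Fin m → ℝ) (V : Set E) (hV : V ∈ nhds x₀)
    (hc : ∀ x ∈ V, ∑ i : Fin m, c i * v i x ^ 2 = 0) :
    ∀ i : Fin m, c i = 0 := by
  intro j
  obtain ⟨u, huj, hu⟩ := hind.exists_apply_ne_zero_of_forall_ne j
  have hsum := sum_mul_fderiv_sq_eq_zero
    (fun i => ((hreg i).contDiffAt hU).differentiableAt two_ne_zero) hzero
    (eventually_of_mem hV hc) u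
  rw [Finset.sum_eq_single_of_mem j (Finset.mem_univ j)
    (fun i _ hi => by simp [hu i hi])] at hsum
  exact (mul_eq_zero.1 hsum).resolve_right (pow_ne_zero 2 huj)
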